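/- Let α ∈ (0,1), β ∈ (α,1], and let h ∈ C^{0,β}(ℝ²) (bounded and β-Hölder continuous). Then the convolution K_α ⋆ h is Lipschitz continuous: there exists a constant C > 0, independent of x and x̃, such that for all x, x̃ ∈ ℝ², |(K_α ⋆ h)(x) − (K_α ⋆ h)(x̃)| ≤ C ‖h‖_{C^{0,β}} |x − x̃|. -/

import Mathlib

open MeasureTheory Real Set Filter
open scoped RealInnerProductSpace FourierTransform Topology

noncomputable section

/-- The plane `ℝ²` with the Euclidean norm. -/
abbrev R2 := EuclideanSpace ℝ (Fin 2)

/-- The point `(a, b)` of `ℝ²`. -/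
def mk2 (a b : ℝ) : R2 := (EuclideanSpace.equiv (Fin 2) ℝ).symm ![a, b]

/-- The perpendicular vector: `(z₁, z₂)^⊥ = (z₂, -z₁)`. -/
def perp (z : R2) : R2 := mk2 (z 1) (-(z 0))

/-- The `α`-SQG kernel `K_α(z) = z^⊥ / |z|^{2+α}`. -/
def Kal (α : ℝ) (z : R2) : R2 := ‖z‖ ^ (-(2 + α)) • perp z

/-- The `α`-SQG velocity `u = K_α ⋆ θ`, `u(x) = ∫ (x-y)^⊥/|x-y|^{2+α} θ(y) dy`. -/
def vel (α : ℝ) (θ : R2 → ℝ) (x : R2) : R2 := ∫ y, θ y • Kal α (x - y)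

/-- Sup norm `‖h‖_{L^∞}` (as a supremum). -/
def supNorm (h : R2 → ℝ) : ℝ := ⨆ x, |h x|

/-- Hölder seminorm of exponent `γ`: `sup_{x ≠ y} |h x - h y| / ‖x - y‖^γ`. -/
def holderSemi (γ : ℝ) (h : R2 → ℝ) : ℝ :=
  ⨆ p : {q : R2 × R2 // q.1 ≠ q.2}, |h p.1.1 - h p.1.2| / ‖p.1.1 - p.1.2‖ ^ γ

/-- The Hölder norm `‖h‖_{C^{0,γ}} = ‖h‖_{L^∞} + [h]_{C^{0,γ}}`. -/
def holderNorm (γ : ℝ) (h : R2 → ℝ) : ℝ := supNorm h + holderSemi γ h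

/-- Membership in `C^{0,γ}(ℝ²)`: continuous, bounded, with finite Hölder seminorm. -/
def IsHolder (γ : ℝ) (h : R2 → ℝ) : Prop :=
  Continuous h ∧ ∃ C : ℝ, (∀ x, |h x| ≤ C) ∧ ∀ x y, |h x - h y| ≤ C * ‖x - y‖ ^ γ

lemma perp_add (a b : R2) : perp (a + b) = perp a + perp b := by
  ext i; fin_cases i <;> simp [perp, mk2]; ring

lemma perp_smul (c : ℝ) (a : R2) : perp (c • a) = c • perp a := by
  ext i; fin_cases i <;> simp [perp, mk2]

lemma perp_sub (a b : R2) : perp (a - b) = perp a - perp b := by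
  ext i; fin_cases i <;> simp [perp, mk2]; ring

lemma norm_perp (a : R2) : ‖perp a‖ = ‖a‖ := by
  simp [EuclideanSpace.norm_eq, perp, mk2, Fin.sum_univ_two, add_comm]

lemma continuous_perp : Continuous perp := by
  have : LipschitzWith 1 perp := LipschitzWith.of_dist_le_mul fun a b => by
    simp [dist_eq_norm, ← perp_sub, norm_perp]
  exact this.continuous

lemma measurable_Kal (α : ℝ) : Measurable (Kal α) := by
  unfold Kal
  exact (measurable_norm.pow_const _).smul continuous_perp.measurable

/-- Radial majorant. -/
def gm (α β r : ℝ) : ℝ := r ^ (-(2 + α)) * min 1 (r ^ β)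

lemma gm_nonneg (α β : ℝ) {r : ℝ} (hr : 0 ≤ r) : 0 ≤ gm α β r := by
  unfold gm; positivity

lemma integrable_gm (α β : ℝ) (hα : 0 < α) (hβ : α < β) :
    Integrable (fun z : R2 => gm α β ‖z‖) := by
  rw [integrable_fun_norm_addHaar volume (f := gm α β)]
  have hd : Module.finrank ℝ R2 - 1 = 1 := by simp
  rw [hd, ← Ioc_union_Ioi_eq_Ioi (zero_le_one (α := ℝ))]
  have hm : Measurable (gm α β) := by unfold gm; fun_prop
  refine IntegrableOn.union ?_ ?_
  · have h1 : IntegrableOn (fun r : ℝ => r ^ (β - α - 1)) (Ioc 0 1) := by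
      rw [← intervalIntegrable_iff_integrableOn_Ioc_of_le zero_le_one]
      exact intervalIntegral.intervalIntegrable_rpow' (by linarith)
    refine Integrable.mono' h1 (by fun_prop) ?_
    filter_upwards [ae_restrict_mem measurableSet_Ioc] with r hr
    have hr0 : 0 < r := hr.1
    rw [Real.norm_of_nonneg (smul_nonneg (by positivity) (gm_nonneg α β hr0.le))]
    unfold gm
    calc r ^ 1 • (r ^ (-(2 + α)) * min 1 (r ^ β)) ≤ r ^ (1:ℝ) * (r ^ (-(2 + α)) * r ^ β) := by
          rw [smul_eq_mul, pow_one, rpow_one]; gcongr; exact min_le_right _ _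
      _ = r ^ (β - α - 1) := by
          rw [← rpow_add hr0, ← rpow_add hr0]; congr 1; ring
  · have h1 : IntegrableOn (fun r : ℝ => r ^ (-1 - α)) (Ioi 1) :=
      integrableOn_Ioi_rpow_of_lt (by linarith) one_pos
    refine Integrable.mono' h1 (by fun_prop) ?_
    filter_upwards [ae_restrict_mem measurableSet_Ioi] with r hr
    have hr0 : 0 < r := lt_trans one_pos hr
    rw [Real.norm_of_nonneg (smul_nonneg (by positivity) (gm_nonneg α β hr0.le))]
    unfold gm
    calc r ^ 1 • (r ^ (-(2 + α)) * min 1 (r ^ β)) ≤ r ^ (1:ℝ) * (r ^ (-(2 + α)) * 1) := by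
          rw [smul_eq_mul, pow_one, rpow_one]; gcongr; exact min_le_left _ _
      _ = r ^ (-1 - α) := by
          rw [mul_one, ← rpow_add hr0]; congr 1; ring

lemma Kal_eq (α : ℝ) {a : R2} (ha : a ≠ 0) :
    Kal α a = ‖a‖ ^ (-α) • perp ((1 / ‖a‖) ^ 2 • a) := by
  have h : 0 < ‖a‖ := norm_pos_iff.2 ha
  rw [perp_smul, smul_smul, Kal]
  congr 1
  rw [show -(2 + α) = -α + -2 by ring, rpow_add h]
  congr 1
  rw [rpow_neg h.le]; norm_num

lemma Kal_diff (α : ℝ) (hα : α ∈ Set.Ioo (0:ℝ) 1) {a b : R2} (ha : a ≠ 0) (hb : b ≠ 0)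
    (hab : ‖a‖ ≤ ‖b‖) :
    ‖Kal α a - Kal α b‖ ≤ 2 * ‖a - b‖ * (‖a‖ ^ (-(1 + α)) * ‖b‖⁻¹) := by
  have pa : 0 < ‖a‖ := norm_pos_iff.2 ha
  have pb : 0 < ‖b‖ := norm_pos_iff.2 hb
  have e : Kal α a - Kal α b =
      ‖a‖ ^ (-α) • perp ((1 / ‖a‖) ^ 2 • a - (1 / ‖b‖) ^ 2 • b)
        + (‖a‖ ^ (-α) - ‖b‖ ^ (-α)) • perp ((1 / ‖b‖) ^ 2 • b) := by
    rw [Kal_eq α ha, Kal_eq α hb, perp_sub]; module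
  have hA : 0 < ‖a‖ ^ (-α) := rpow_pos_of_pos pa _
  have h1 : ‖(1 / ‖a‖) ^ 2 • a - (1 / ‖b‖) ^ 2 • b‖ = ‖a - b‖ * (‖a‖⁻¹ * ‖b‖⁻¹) := by
    rw [← dist_eq_norm, dist_div_norm_sq_smul ha hb, dist_eq_norm]; field_simp
  have h2 : ‖(1 / ‖b‖) ^ 2 • b‖ = ‖b‖⁻¹ := by
    rw [norm_smul, norm_pow, norm_div, norm_norm, norm_one]; field_simp
  have h3 : ‖b‖ ^ (-α) ≤ ‖a‖ ^ (-α) := rpow_le_rpow_of_nonpos pa hab (by linarith [hα.1])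
  have h4 : ‖a‖ ^ (-α) - ‖b‖ ^ (-α) ≤ ‖a‖ ^ (-α) * (‖a - b‖ * ‖a‖⁻¹) := by
    have t : ‖b‖ ^ (-α) = ‖a‖ ^ (-α) * (‖a‖ / ‖b‖) ^ α := by
      rw [div_rpow pa.le pb.le, rpow_neg pa.le, rpow_neg pb.le]
      have := rpow_pos_of_pos pa α
      field_simp
    have t2 : ‖a‖ / ‖b‖ ≤ (‖a‖ / ‖b‖) ^ α := by
      have := rpow_le_rpow_of_exponent_ge (x := ‖a‖ / ‖b‖) (by positivity)
        ((div_le_one pb).2 hab) hα.2.le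
      rwa [rpow_one] at this
    have t3 : ‖b‖ - ‖a‖ ≤ ‖a - b‖ := by
      rw [norm_sub_rev]; exact norm_sub_norm_le _ _
    have t4 : 1 - ‖a‖ / ‖b‖ ≤ ‖a - b‖ * ‖a‖⁻¹ := by
      calc 1 - ‖a‖ / ‖b‖ = (‖b‖ - ‖a‖) * ‖b‖⁻¹ := by field_simp
        _ ≤ ‖a - b‖ * ‖a‖⁻¹ := by gcongr
    rw [t]
    have := mul_le_mul_of_nonneg_left (show 1 - (‖a‖ / ‖b‖) ^ α ≤ ‖a - b‖ * ‖a‖⁻¹ by linarith) hA.le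
    linarith
  have h5 : ‖a‖ ^ (-(1 + α)) = ‖a‖ ^ (-α) * ‖a‖⁻¹ := by
    rw [show -(1 + α) = -α + -1 by ring, rpow_add pa, rpow_neg_one]
  rw [e, h5]
  refine (norm_add_le _ _).trans ?_
  rw [norm_smul, norm_smul, norm_perp, norm_perp, h1, h2, Real.norm_of_nonneg hA.le,
    Real.norm_of_nonneg (sub_nonneg.2 h3)]
  have := mul_le_mul_of_nonneg_right h4 (inv_nonneg.2 pb.le)
  linarith

lemma min_mul_inv_anti {β : ℝ} (hβ1 : β ≤ 1) {r s : ℝ} (hr : 0 < r) (hrs : r ≤ s) :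
    min 1 (s ^ β) * s⁻¹ ≤ min 1 (r ^ β) * r⁻¹ := by
  have hs : 0 < s := hr.trans_le hrs
  rw [min_mul_of_nonneg _ _ (inv_nonneg.2 hr.le), min_mul_of_nonneg _ _ (inv_nonneg.2 hs.le)]
  refine min_le_min ?_ ?_
  · gcongr
  · rw [← rpow_neg_one, ← rpow_neg_one, ← rpow_add hs, ← rpow_add hr]
    exact rpow_le_rpow_of_nonpos hr hrs (by linarith)

lemma gm_eq (α β : ℝ) {r : ℝ} (hr : 0 < r) :
    gm α β r = r ^ (-(1 + α)) * (min 1 (r ^ β) * r⁻¹) := by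
  rw [gm, show -(2 + α) = -(1 + α) + -1 by ring, rpow_add hr, rpow_neg_one]; ring

lemma key_bound (α β : ℝ) (hα : α ∈ Set.Ioo (0:ℝ) 1) (hβ1 : β ≤ 1) {z w : R2}
    (hz : z ≠ 0) (hw : w ≠ 0) :
    min 1 (‖z‖ ^ β) * ‖Kal α z - Kal α w‖ ≤ 2 * ‖z - w‖ * (gm α β ‖z‖ + gm α β ‖w‖) := by
  have pz : 0 < ‖z‖ := norm_pos_iff.2 hz
  have pw : 0 < ‖w‖ := norm_pos_iff.2 hw
  have gz := gm_nonneg α β pz.le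
  have gw := gm_nonneg α β pw.le
  have hm : 0 ≤ min 1 (‖z‖ ^ β) := by positivity
  rcases le_total ‖z‖ ‖w‖ with h | h
  · calc min 1 (‖z‖ ^ β) * ‖Kal α z - Kal α w‖
        ≤ min 1 (‖z‖ ^ β) * (2 * ‖z - w‖ * (‖z‖ ^ (-(1 + α)) * ‖w‖⁻¹)) := by
          gcongr; exact Kal_diff α hα hz hw h
      _ ≤ min 1 (‖z‖ ^ β) * (2 * ‖z - w‖ * (‖z‖ ^ (-(1 + α)) * ‖z‖⁻¹)) := by gcongr
      _ = 2 * ‖z - w‖ * gm α β ‖z‖ := by rw [gm_eq α β pz]; ring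
      _ ≤ _ := by gcongr; linarith
  · calc min 1 (‖z‖ ^ β) * ‖Kal α z - Kal α w‖
        ≤ min 1 (‖z‖ ^ β) * (2 * ‖z - w‖ * (‖w‖ ^ (-(1 + α)) * ‖z‖⁻¹)) := by
          gcongr; rw [norm_sub_rev, norm_sub_rev z]; exact Kal_diff α hα hw hz h
      _ = 2 * ‖z - w‖ * (‖w‖ ^ (-(1 + α)) * (min 1 (‖z‖ ^ β) * ‖z‖⁻¹)) := by ring
      _ ≤ 2 * ‖z - w‖ * (‖w‖ ^ (-(1 + α)) * (min 1 (‖w‖ ^ β) * ‖w‖⁻¹)) := by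
          have := min_mul_inv_anti hβ1 pw h
          gcongr
      _ = 2 * ‖z - w‖ * gm α β ‖w‖ := by rw [gm_eq α β pw]
      _ ≤ _ := by gcongr; linarith

lemma crude_aux (α : ℝ) (hα : α ∈ Set.Ioo (0:ℝ) 1) {z w : R2}
    (hz : z ≠ 0) (hw : w ≠ 0) (h : ‖z‖ ≤ ‖w‖) :
    ‖Kal α z - Kal α w‖ ≤ (2 * ‖z - w‖ + 4) * gm α 1 ‖z‖ := by
  have pz : 0 < ‖z‖ := norm_pos_iff.2 hz
  have pw : 0 < ‖w‖ := norm_pos_iff.2 hw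
  have hd : ‖z - w‖ ≤ 2 * ‖w‖ := by linarith [norm_sub_le z w]
  refine (Kal_diff α hα hz hw h).trans ?_
  rw [gm_eq α 1 pz, rpow_one]
  have hp := rpow_pos_of_pos pz (-(1 + α))
  have : 2 * ‖z - w‖ * ‖w‖⁻¹ ≤ (2 * ‖z - w‖ + 4) * (min 1 ‖z‖ * ‖z‖⁻¹) := by
    rcases le_total 1 ‖z‖ with h1 | h1
    · rw [min_eq_left h1, one_mul]
      have : 2 * ‖z - w‖ ≤ 2 * ‖z - w‖ + 4 := by linarith
      gcongr
    · rw [min_eq_right h1, mul_inv_cancel₀ pz.ne', mul_one]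
      have : 2 * ‖z - w‖ * ‖w‖⁻¹ ≤ 4 := by
        rw [← div_eq_mul_inv, div_le_iff₀ pw]; linarith
      linarith [norm_nonneg (z - w)]
  have := mul_le_mul_of_nonneg_left this hp.le
  linarith

lemma crude (α : ℝ) (hα : α ∈ Set.Ioo (0:ℝ) 1) {z w : R2} (hz : z ≠ 0) (hw : w ≠ 0) :
    ‖Kal α z - Kal α w‖ ≤ (2 * ‖z - w‖ + 4) * (gm α 1 ‖z‖ + gm α 1 ‖w‖) := by
  have gz := gm_nonneg α 1 (norm_nonneg z)
  have gw := gm_nonneg α 1 (norm_nonneg w)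
  rcases le_total ‖z‖ ‖w‖ with h | h
  · refine (crude_aux α hα hz hw h).trans ?_
    gcongr; linarith
  · rw [norm_sub_rev, norm_sub_rev z]
    refine (crude_aux α hα hw hz h).trans ?_
    gcongr; linarith

lemma ae_ne (e : R2) : ∀ᵐ z : R2, z ≠ e := by
  rw [ae_iff]; simp

lemma integrable_gm2 (α β : ℝ) (hα : 0 < α) (hβ : α < β) (e : R2) :
    Integrable (fun z : R2 => gm α β ‖z‖ + gm α β ‖z - e‖) :=
  (integrable_gm α β hα hβ).add ((integrable_gm α β hα hβ).comp_sub_right e)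

lemma integrable_F (α : ℝ) (hα : α ∈ Set.Ioo (0:ℝ) 1) (e : R2) :
    Integrable (fun z : R2 => Kal α z - Kal α (z - e)) := by
  refine Integrable.mono' ((integrable_gm2 α 1 hα.1 hα.2 e).const_mul (2 * ‖e‖ + 4)) ?_ ?_
  · exact ((measurable_Kal α).sub
      ((measurable_Kal α).comp (measurable_id.sub_const e))).aestronglyMeasurable
  · filter_upwards [ae_ne 0, ae_ne e] with z h0 h1
    have := crude α hα h0 (sub_ne_zero.2 h1)
    rwa [sub_sub_cancel] at this

lemma Kal_two (α : ℝ) (z : R2) : Kal α ((2:ℝ) • z) = (2:ℝ) ^ (-(1 + α)) • Kal α z := by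
  unfold Kal
  rw [perp_smul, norm_smul, Real.norm_of_nonneg zero_le_two,
    mul_rpow zero_le_two (norm_nonneg z), smul_smul, smul_smul]
  congr 1
  rw [show -(1 + α) = -(2 + α) + 1 by ring, rpow_add two_pos, rpow_one]; ring

lemma integral_F (α : ℝ) (hα : α ∈ Set.Ioo (0:ℝ) 1) (e : R2) :
    ∫ z : R2, (Kal α z - Kal α (z - e)) = 0 := by
  set G := ∫ z : R2, (Kal α z - Kal α (z - e)) with hG
  have hF := integrable_F α hα e
  have h1 : ∫ z : R2, (Kal α z - Kal α (z - (2:ℝ) • e)) = (2:ℝ) • G := by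
    have : ∀ z : R2, Kal α z - Kal α (z - (2:ℝ) • e) =
        (Kal α z - Kal α (z - e)) + (Kal α (z - e) - Kal α (z - e - e)) := by
      intro z
      rw [show z - (2:ℝ) • e = z - e - e by module]; abel
    simp_rw [this]
    rw [integral_add hF (hF.comp_sub_right e),
      integral_sub_right_eq_self (fun z : R2 => Kal α z - Kal α (z - e)) e, two_smul]
  have h2 := Measure.integral_comp_smul (volume : Measure R2)
    (fun z : R2 => Kal α z - Kal α (z - (2:ℝ) • e)) 2
  simp only [← smul_sub, Kal_two] at h2
  rw [integral_smul, h1, ← hG, smul_smul, finrank_euclideanSpace_fin] at h2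
  have h3 : ((2:ℝ) ^ (-(1 + α)) - |((2:ℝ) ^ 2)⁻¹| * 2) • G = 0 := by
    rw [sub_smul, h2, sub_self]
  rcases smul_eq_zero.1 h3 with h | h
  · exfalso
    have h4 : (2:ℝ) ^ (-(1 + α)) < (2:ℝ) ^ (-1 : ℝ) :=
      rpow_lt_rpow_of_exponent_lt one_lt_two (by linarith [hα.1])
    rw [rpow_neg_one] at h4
    norm_num at h h4
    linarith
  · exact h

lemma holder_bound {β : ℝ} {h : R2 → ℝ} (hh : IsHolder β h) :
    0 ≤ holderNorm β h ∧
      ∀ y x : R2, x ≠ y → |h y - h x| ≤ 2 * holderNorm β h * min 1 (‖x - y‖ ^ β) := by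
  obtain ⟨-, C, hC1, hC2⟩ := hh
  have b1 : BddAbove (range fun x => |h x|) := ⟨C, by rintro _ ⟨x, rfl⟩; exact hC1 x⟩
  have b2 : BddAbove (range fun p : {q : R2 × R2 // q.1 ≠ q.2} =>
      |h p.1.1 - h p.1.2| / ‖p.1.1 - p.1.2‖ ^ β) := by
    refine ⟨C, ?_⟩
    rintro _ ⟨p, rfl⟩
    have : 0 < ‖p.1.1 - p.1.2‖ := norm_pos_iff.2 (sub_ne_zero.2 p.2)
    exact (div_le_iff₀ (rpow_pos_of_pos this β)).2 (hC2 _ _)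
  have s1 : ∀ x, |h x| ≤ supNorm h := fun x => le_ciSup b1 x
  have n1 : 0 ≤ supNorm h := (abs_nonneg _).trans (s1 0)
  have n2 : 0 ≤ holderSemi β h := Real.iSup_nonneg fun p => by positivity
  refine ⟨add_nonneg n1 n2, fun y x hxy => ?_⟩
  have pp : 0 < ‖x - y‖ := norm_pos_iff.2 (sub_ne_zero.2 hxy)
  have s2 : |h x - h y| ≤ holderSemi β h * ‖x - y‖ ^ β :=
    (div_le_iff₀ (rpow_pos_of_pos pp β)).1 (le_ciSup b2 ⟨(x, y), hxy⟩)
  have pr := rpow_pos_of_pos pp β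
  unfold holderNorm
  rw [mul_min_of_nonneg _ _ (by positivity)]
  refine le_min ?_ ?_
  · have := abs_sub (h y) (h x)
    linarith [s1 x, s1 y]
  · rw [abs_sub_comm]
    refine s2.trans ?_
    gcongr; linarith

/-- **Lipschitz continuity of the velocity (Corollary 2.2).**  For `h ∈ C^{0,β}(ℝ²)` with
`α < β ≤ 1`, `|(K_α ⋆ h)(x) - (K_α ⋆ h)(x̃)| ≤ C ‖h‖_{C^{0,β}} |x-x̃|`,
with `C` independent of `x, x̃` (and of `h`). -/
theorem lipschitz_velocity (α β : ℝ) (hα : α ∈ Set.Ioo (0:ℝ) 1) (hβ : β ∈ Set.Ioc α 1) :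
    ∃ C > 0, ∀ h : R2 → ℝ, IsHolder β h → ∀ x xt : R2,
      ‖∫ y, h y • (Kal α (x - y) - Kal α (xt - y))‖ ≤ C * holderNorm β h * ‖x - xt‖ := by
  obtain ⟨hβ0, hβ1⟩ := hβ
  set A := ∫ z : R2, gm α β ‖z‖ with hA
  have hA0 : 0 ≤ A := integral_nonneg fun z => gm_nonneg α β (norm_nonneg z)
  refine ⟨8 * A + 1, by positivity, fun h hh x xt => ?_⟩
  obtain ⟨hN, hb⟩ := holder_bound hh
  set N := holderNorm β h
  have hc : Continuous h := hh.1
  set e := x - xt with he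
  have hcv : ∫ y, h y • (Kal α (x - y) - Kal α (xt - y))
      = ∫ z, h (x - z) • (Kal α z - Kal α (z - e)) := by
    rw [← integral_sub_left_eq_self _ volume x]
    congr 1; ext1 z
    rw [sub_sub_cancel, show xt - (x - z) = z - e by rw [he]; abel]
  have hF := integrable_F α hα e
  have hg := integrable_gm2 α β hα.1 hβ0 e
  have hbd : ∀ᵐ z : R2, ‖(h (x - z) - h x) • (Kal α z - Kal α (z - e))‖ ≤
      4 * N * ‖e‖ * (gm α β ‖z‖ + gm α β ‖z - e‖) := by
    filter_upwards [ae_ne 0, ae_ne e] with z h0 h1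
    have k := key_bound α β hα hβ1 h0 (sub_ne_zero.2 h1)
    rw [sub_sub_cancel] at k
    have k2 := hb (x - z) x (fun hx => h0 (by simpa using hx.symm))
    rw [sub_sub_cancel] at k2
    rw [norm_smul, Real.norm_eq_abs]
    calc _ ≤ 2 * N * min 1 (‖z‖ ^ β) * ‖Kal α z - Kal α (z - e)‖ := by gcongr
      _ = 2 * N * (min 1 (‖z‖ ^ β) * ‖Kal α z - Kal α (z - e)‖) := by ring
      _ ≤ 2 * N * (2 * ‖e‖ * (gm α β ‖z‖ + gm α β ‖z - e‖)) := by gcongr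
      _ = _ := by ring
  have hmeas : AEStronglyMeasurable
      (fun z : R2 => (h (x - z) - h x) • (Kal α z - Kal α (z - e))) volume :=
    ((hc.comp (continuous_const.sub continuous_id)).sub
      continuous_const).aestronglyMeasurable.smul hF.1
  have hi := Integrable.mono' (hg.const_mul (4 * N * ‖e‖)) hmeas hbd
  have hsplit : ∫ z, h (x - z) • (Kal α z - Kal α (z - e)) =
      ∫ z, (h (x - z) - h x) • (Kal α z - Kal α (z - e)) := by
    have : ∀ z, h (x - z) • (Kal α z - Kal α (z - e)) =
        (h (x - z) - h x) • (Kal α z - Kal α (z - e)) + h x • (Kal α z - Kal α (z - e)) := by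
      intro z; rw [← add_smul, sub_add_cancel]
    have hs : Integrable (fun z : R2 => h x • (Kal α z - Kal α (z - e))) := hF.smul (h x)
    simp_rw [this]
    rw [integral_add hi hs, integral_smul, integral_F α hα e, smul_zero, add_zero]
  rw [hcv, hsplit]
  refine (norm_integral_le_of_norm_le (hg.const_mul (4 * N * ‖e‖)) hbd).trans ?_
  rw [integral_const_mul, integral_add (integrable_gm α β hα.1 hβ0)
    ((integrable_gm α β hα.1 hβ0).comp_sub_right e),
    integral_sub_right_eq_self (fun z : R2 => gm α β ‖z‖) e, ← hA]
  have : 0 ≤ N * ‖e‖ := by positivity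
  linarith
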